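/- Let (s₀, i₀) ∈ 𝕋 with i₀ > 0 and s₀ > γ/β_*, and let b be an admissible control whose trajectory satisfies i^{s₀,i₀,b}(t) ≤ i_M for all t ≥ 0. Then, as long as s^{s₀,i₀,b}(t) ≥ γ/β_*, one has i^{s₀,i₀,b}(t) ≥ i₀ and s^{s₀,i₀,b}(t) ≤ s₀·e^{−β_* i₀ t}; consequently there exists a (unique) time t₁ > 0 with s^{s₀,i₀,b}(t₁) = γ/β_*, and at that time i^{s₀,i₀,b}(t₁) ≤ i_M. In particular every viable trajectory starting outside ℬ₀ := ([0, γ/β_*] × [0, i_M]) ∩ 𝕋 reaches ℬ₀ in finite time. -/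

import Mathlib

open MeasureTheory Set Real
open scoped ENNReal

noncomputable section

/-- An admissible control: a Borel-measurable function with values in `[βs, β]`. -/
def IsAdmissible (βs β : ℝ) (b : ℝ → ℝ) : Prop :=
  Measurable b ∧ ∀ t, b t ∈ Set.Icc βs β

/-- `(s, i)` is the trajectory of the controlled SIR system `s' = -b s i`,
`i' = b s i - γ i` issued from `(s₀, i₀)`, in integral (Carathéodory) form. -/
def IsTrajectory (γ : ℝ) (b : ℝ → ℝ) (s₀ i₀ : ℝ) (s i : ℝ → ℝ) : Prop :=
  Continuous s ∧ Continuous i ∧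
    (∀ t : ℝ, s t = s₀ - ∫ r in (0:ℝ)..t, b r * s r * i r) ∧
    (∀ t : ℝ, i t = i₀ + ∫ r in (0:ℝ)..t, (b r * s r - γ) * i r)

/-- Membership in the triangle `𝕋 = {(s,i) : s ≥ 0, i ≥ 0, s + i ≤ 1}`. -/
def MemT (s i : ℝ) : Prop := 0 ≤ s ∧ 0 ≤ i ∧ s + i ≤ 1

/-- The boundary functions `Φ_A` (with `βx = β`, `sM = s_M`) and `Φ_B`
(with `βx = β_*`, `sM = s_M^*`). -/
def Phi (γ βx iM sM : ℝ) (s : ℝ) : ℝ :=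
  if s ≤ γ / βx then iM
  else if s < sM then iM - s + γ / βx + (γ / βx) * Real.log (βx * s / γ)
  else 0

/-- The cost functional `J(t_f, b) = ∫₀^{t_f} (λ₁ + λ₂ (β - b(t))) dt`. -/
def cost (β lam1 lam2 tf : ℝ) (b : ℝ → ℝ) : ℝ :=
  ∫ t in (0:ℝ)..tf, (lam1 + lam2 * (β - b t))

/-- Gronwall in integral-increment form. -/
theorem aux_gron (f : ℝ → ℝ) (hf : Continuous f) (K T : ℝ) (hT : 0 ≤ T)
    (h : ∀ u v, 0 ≤ u → u ≤ v → v ≤ T → f v - f u ≤ K * ∫ r in u..v, f r) :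
    f T ≤ f 0 * Real.exp (K * T) := by
  have key := le_gronwallBound_of_liminf_deriv_right_le (f := f) (f' := fun x => K * f x)
    (δ := f 0) (K := K) (ε := 0) (a := 0) (b := T) hf.continuousOn ?_ le_rfl
    (fun x _ => by simp) T ⟨hT, le_rfl⟩
  · rw [gronwallBound_ε0] at key
    simpa using key
  · intro x hx r hr
    apply Filter.Eventually.frequently
    have hd : HasDerivAt (fun z => K * ∫ r in x..z, f r) (K * f x) x :=
      (intervalIntegral.integral_hasDerivAt_right (hf.intervalIntegrable _ _)
        (hf.stronglyMeasurableAtFilter _ _) hf.continuousAt).const_mul K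
    have ht := (hasDerivAt_iff_tendsto_slope.1 hd).mono_left
      (nhdsWithin_mono x (fun y (hy : x < y) => ne_of_gt hy))
    have hev := ht.eventually (gt_mem_nhds hr)
    filter_upwards [hev, Ioc_mem_nhdsGT hx.2] with z hz hzI
    refine lt_of_le_of_lt ?_ hz
    rw [slope_def_field]
    have h1 := h x z hx.1 hzI.1.le hzI.2
    have : 0 < z - x := sub_pos.2 hzI.1
    simp only [intervalIntegral.integral_same, mul_zero, sub_zero]
    rw [div_eq_inv_mul]
    gcongr

theorem aux_pos (x a : ℝ → ℝ) (x0 M : ℝ) (hx : Continuous x) (hx0 : 0 < x0)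
    (hint : ∀ u v, IntervalIntegrable (fun r => a r * x r) volume u v)
    (hxe : ∀ t, x t = x0 + ∫ r in (0:ℝ)..t, a r * x r)
    (hM : ∀ r, 0 ≤ r → -M ≤ a r) : ∀ t, 0 ≤ t → 0 < x t := by
  have h0 : x 0 = x0 := by rw [hxe]; simp
  intro t ht
  by_contra hneg
  push Not at hneg
  let Z := {r | r ∈ Icc 0 t ∧ x r ≤ 0}
  have hZc : IsCompact Z := by
    have : Z = Icc 0 t ∩ {r | x r ≤ 0} := rfl
    rw [this]
    exact isCompact_Icc.inter_right (isClosed_le hx continuous_const)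
  obtain ⟨τ, hτ, hmin⟩ := hZc.exists_isLeast ⟨t, ⟨ht, le_rfl⟩, hneg⟩
  have hτ0 : 0 ≤ τ := hτ.1.1
  have hlt : ∀ r, 0 ≤ r → r < τ → 0 < x r := by
    intro r hr hrt
    by_contra hc
    push Not at hc
    have := hmin (show r ∈ Z from ⟨⟨hr, hrt.le.trans hτ.1.2⟩, hc⟩)
    linarith
  have := aux_gron (fun r => - x r) hx.neg (-M) τ hτ0 ?_
  · have h1 := Real.exp_pos (-M * τ)
    have h2 := hτ.2
    simp only [h0] at this
    nlinarith
  · intro u v hu huv hv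
    have e : x v - x u = ∫ r in u..v, a r * x r := by
      rw [hxe v, hxe u, ← intervalIntegral.integral_interval_sub_left (hint 0 v) (hint 0 u)]
      ring
    have : ∫ r in u..v, (-M) * x r ≤ ∫ r in u..v, a r * x r := by
      apply intervalIntegral.integral_mono_on_of_le_Ioo huv
        ((continuous_const.mul hx).intervalIntegrable _ _) (hint u v)
      intro r hr
      exact mul_le_mul_of_nonneg_right (hM r (by linarith [hr.1]))
        (hlt r (by linarith [hr.1]) (by linarith [hr.2])).le
    rw [intervalIntegral.integral_const_mul] at this
    rw [intervalIntegral.integral_neg]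
    linarith

theorem aux_int (βs β : ℝ) (b : ℝ → ℝ) (hβs : 0 < βs) (hb : IsAdmissible βs β b) (g : ℝ → ℝ)
    (hg : Continuous g) (u v : ℝ) : IntervalIntegrable (fun r => b r * g r) volume u v := by
  have h1 : IntervalIntegrable (fun r => β * ‖g r‖) volume u v :=
    (continuous_const.mul hg.norm).intervalIntegrable _ _
  refine h1.mono_fun (hb.1.mul hg.measurable).aestronglyMeasurable ?_
  refine Filter.Eventually.of_forall fun r => ?_
  have := hb.2 r
  have hbr : 0 < b r := hβs.trans_le this.1
  simp only [norm_mul, norm_norm, Real.norm_eq_abs, abs_abs]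
  rw [abs_of_pos hbr, abs_of_pos (hbr.trans_le this.2)]
  exact mul_le_mul_of_nonneg_right this.2 (abs_nonneg _)

/-- for a viable trajectory starting at `(s₀,i₀) ∈ 𝕋` with
`i₀ > 0` and `s₀ > γ/β_*`: as long as `s ≥ γ/β_*` one has `i ≥ i₀` and
`s(t) ≤ s₀ e^{-β_* i₀ t}`; there is a unique `t₁ > 0` with `s(t₁) = γ/β_*`,
and at that time `i(t₁) ≤ i_M` (the trajectory reaches `ℬ₀` in finite time). -/
theorem stmt7 (γ βs β iM : ℝ) (hγ : 0 < γ) (hβs : 0 < βs) (hβ : βs < β)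
    (hiM : 0 < iM) (hiM1 : iM < 1)
    (s₀ i₀ : ℝ) (hT : MemT s₀ i₀) (hi₀ : 0 < i₀) (hs₀ : γ / βs < s₀)
    (b s i : ℝ → ℝ) (hb : IsAdmissible βs β b)
    (htraj : IsTrajectory γ b s₀ i₀ s i)
    (hviab : ∀ t : ℝ, 0 ≤ t → i t ≤ iM) :
    (∀ t : ℝ, 0 ≤ t → (∀ r ∈ Set.Icc (0:ℝ) t, γ / βs ≤ s r) →
      i₀ ≤ i t ∧ s t ≤ s₀ * Real.exp (-(βs * i₀ * t))) ∧
    (∃! t₁ : ℝ, 0 < t₁ ∧ s t₁ = γ / βs) ∧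
    (∀ t₁ : ℝ, 0 < t₁ → s t₁ = γ / βs → i t₁ ≤ iM) := by
  obtain ⟨hsc, hic, hse, hie⟩ := htraj
  have hbp : ∀ r, 0 < b r := fun r => hβs.trans_le (hb.2 r).1
  have hc0 : 0 < γ / βs := div_pos hγ hβs
  have hsp0 : 0 < s₀ := hc0.trans hs₀
  have hs00 : s 0 = s₀ := by rw [hse]; simp
  have hi00 : i 0 = i₀ := by rw [hie]; simp
  have hint1 : ∀ u v, IntervalIntegrable (fun r => b r * s r * i r) volume u v := by
    intro u v
    have := aux_int βs β b hβs hb (fun r => s r * i r) (hsc.mul hic) u v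
    simpa only [mul_assoc] using this
  have hint2 : ∀ u v, IntervalIntegrable (fun r => (b r * s r - γ) * i r) volume u v := by
    intro u v
    have := (hint1 u v).sub ((continuous_const.mul hic).intervalIntegrable u v :
      IntervalIntegrable (fun r => γ * i r) volume u v)
    refine this.congr ?_
    intro r _
    show b r * s r * i r - γ * i r = (b r * s r - γ) * i r
    ring
  have eS : ∀ u v, s v - s u = - ∫ r in u..v, b r * s r * i r := by
    intro u v
    rw [hse v, hse u, ← intervalIntegral.integral_interval_sub_left (hint1 0 v) (hint1 0 u)]
    ring
  have hspos : ∀ t, 0 ≤ t → 0 < s t := by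
    have hfe : (fun r => (-(b r * i r)) * s r) = fun r => -(b r * s r * i r) := by
      funext r; ring
    refine aux_pos s (fun r => -(b r * i r)) s₀ (β * iM) hsc hsp0 ?_ ?_ ?_
    · intro u v
      rw [hfe]
      exact (hint1 u v).neg
    · intro t
      rw [hfe, intervalIntegral.integral_neg, hse t]
      ring
    · intro r hr
      have h1 := hviab r hr
      have h2 := hbp r
      have h3 := (hb.2 r).2
      have : b r * i r ≤ b r * iM := mul_le_mul_of_nonneg_left h1 h2.le
      have : b r * iM ≤ β * iM := mul_le_mul_of_nonneg_right h3 hiM.le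
      linarith
  have hipos : ∀ t, 0 ≤ t → 0 < i t := by
    refine aux_pos i (fun r => b r * s r - γ) i₀ γ hic hi₀ hint2 hie ?_
    intro r hr
    have := mul_pos (hbp r) (hspos r hr)
    linarith
  have hanti : ∀ u v, 0 ≤ u → u < v → s v < s u := by
    intro u v hu huv
    have := eS u v
    have : 0 < ∫ r in u..v, b r * s r * i r := by
      apply intervalIntegral.intervalIntegral_pos_of_pos_on (hint1 u v) _ huv
      intro r hr
      have hr0 : 0 ≤ r := by linarith [hr.1]
      exact mul_pos (mul_pos (hbp r) (hspos r hr0)) (hipos r hr0)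
    linarith
  have A : ∀ t : ℝ, 0 ≤ t → (∀ r ∈ Set.Icc (0:ℝ) t, γ / βs ≤ s r) → i₀ ≤ i t := by
    intro t ht h
    rw [hie t]
    have : 0 ≤ ∫ r in (0:ℝ)..t, (b r * s r - γ) * i r := by
      apply intervalIntegral.integral_nonneg ht
      intro r hr
      refine mul_nonneg ?_ (hipos r hr.1).le
      have h1 := h r hr
      have h2 : γ ≤ s r * βs := (div_le_iff₀ hβs).1 h1
      have h3 := mul_le_mul_of_nonneg_right (hb.2 r).1 (hspos r hr.1).le
      linarith
    linarith
  have B : ∀ t : ℝ, 0 ≤ t → (∀ r ∈ Set.Icc (0:ℝ) t, γ / βs ≤ s r) →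
      s t ≤ s₀ * Real.exp (-(βs * i₀ * t)) := by
    intro t ht h
    have := aux_gron s hsc (-(βs * i₀)) t ht ?_
    · rw [hs00] at this
      rwa [← neg_mul]
    · intro u v hu huv hv
      rw [eS u v]
      have : ∫ r in u..v, (βs * i₀) * s r ≤ ∫ r in u..v, b r * s r * i r := by
        apply intervalIntegral.integral_mono_on huv
          ((continuous_const.mul hsc).intervalIntegrable _ _) (hint1 u v)
        intro r hr
        have hr0 : 0 ≤ r := hu.trans hr.1
        have h1 := A r hr0 (fun q hq => h q ⟨hq.1, hq.2.trans (hr.2.trans hv)⟩)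
        have h2 : βs * i₀ ≤ b r * i r := mul_le_mul (hb.2 r).1 h1 hi₀.le (hbp r).le
        have h3 := mul_le_mul_of_nonneg_right h2 (hspos r hr0).le
        show βs * i₀ * s r ≤ b r * s r * i r
        linarith
      rw [intervalIntegral.integral_const_mul] at this
      linarith
  refine ⟨fun t ht h => ⟨A t ht h, B t ht h⟩, ?_, fun t₁ h _ => hviab t₁ h.le⟩
  have hex : ∃ t, 0 ≤ t ∧ s t ≤ γ / βs := by
    by_contra hcon
    push Not at hcon
    have hk : 0 < βs * i₀ := mul_pos hβs hi₀
    let X := s₀ / (γ / βs)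
    have hX : 0 < X := div_pos hsp0 hc0
    have hT0 : 0 ≤ X / (βs * i₀) := (div_pos hX hk).le
    have h1 := B _ hT0 (fun r hr => (hcon r hr.1).le)
    rw [mul_div_cancel₀ _ hk.ne', Real.exp_neg, ← div_eq_mul_inv, le_div_iff₀ (Real.exp_pos _)] at h1
    have h2 := hcon _ hT0
    have h3 := Real.add_one_le_exp X
    have h4 : X * (γ / βs) = s₀ := div_mul_cancel₀ _ hc0.ne'
    have h5 := mul_lt_mul_of_pos_right h2 (Real.exp_pos X)
    nlinarith
  obtain ⟨t, ht, hst⟩ := hex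
  obtain ⟨t₁, ht₁, he⟩ := intermediate_value_Icc' ht hsc.continuousOn
    (show γ / βs ∈ Icc (s t) (s 0) from ⟨hst, by rw [hs00]; exact hs₀.le⟩)
  have hpos : 0 < t₁ := by
    rcases ht₁.1.lt_or_eq with h | h
    · exact h
    · rw [← h, hs00] at he
      linarith
  refine ⟨t₁, ⟨hpos, he⟩, ?_⟩
  rintro y ⟨hy, hye⟩
  rcases lt_trichotomy y t₁ with h | h | h
  · have := hanti y t₁ hy.le h
    linarith
  · exact h
  · have := hanti t₁ y hpos.le h
    linarith
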